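/- arXiv:1805.05395 — 8 statements merged into one kernel-verified Lean document; each statement's English description precedes it below -/
import Mathlib

section
/- Fix n ≥ 3 and μ : Fin n → ℝ with μ_i > 0 for all i. Let A be the matrix with A_{i,i⁺} = (μ_{i⁻}+μ_i)/d_i, A_{i,i⁻} = (μ_i+μ_{i⁺})/d_i and A_{i,j} = 0 otherwise, and let L_p = I − A. Define w_L ∈ ℝⁿ by (w_L)_i = d_i · ∏_{j ≠ i, j ≠ i⁻} (μ_j + μ_{j⁺}). Then w_L is a left eigenvector of L_p for the eigenvalue zero: for every column j, Σ_i (w_L)_i · (L_p)_{i,j} = 0. -/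
open Matrix Filter Real

/-- `d i = μ (i⁺) + 2 μ i + μ (i⁻)` with cyclic indices. -/
noncomputable def dCoef {n : ℕ} [NeZero n] (μ : Fin n → ℝ) (i : Fin n) : ℝ :=
  μ (i + 1) + 2 * μ i + μ (i - 1)

/-- The weight matrix of the distributed angular control law. -/
noncomputable def Amat {n : ℕ} [NeZero n] (μ : Fin n → ℝ) : Matrix (Fin n) (Fin n) ℝ :=
  Matrix.of fun i j =>
    if j = i + 1 then (μ (i - 1) + μ i) / dCoef μ i
    else if j = i - 1 then (μ i + μ (i + 1)) / dCoef μ i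
    else 0

/-- The left null vector `w_L` of the Laplacian `L_p = I - A`. -/
noncomputable def wL {n : ℕ} [NeZero n] (μ : Fin n → ℝ) (i : Fin n) : ℝ :=
  dCoef μ i * ∏ j ∈ Finset.univ.filter (fun j => j ≠ i ∧ j ≠ i - 1), (μ j + μ (j + 1))

/-- The constant offset vector `b` of the angular control law. -/
noncomputable def bVec {n : ℕ} [NeZero n] (μ : Fin n → ℝ) (i : Fin n) : ℝ :=
  if i = 0 then -(2 * Real.pi) * (μ 0 + μ 1) / dCoef μ 0
  else if i = -1 then 2 * Real.pi * (μ (-1 - 1) + μ (-1)) / dCoef μ (-1)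
  else 0

/-- The coefficient matrix of the spacing dynamics `Δ' = k_φ M_Δ Δ`. -/
noncomputable def Mdel {n : ℕ} [NeZero n] (μ : Fin n → ℝ) : Matrix (Fin n) (Fin n) ℝ :=
  Matrix.of fun i j =>
    if j = i + 1 then (μ i + μ (i + 1)) / dCoef μ (i + 1)
    else if j = i - 1 then (μ i + μ (i + 1)) / dCoef μ i
    else if j = i then
      -((μ (i + 1) + μ (i + 1 + 1)) / dCoef μ (i + 1)) - (μ (i - 1) + μ i) / dCoef μ i
    else 0


/-- Closed form of `w_L` as a quotient of the full cyclic product. -/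
theorem wL_eq_aux {n : ℕ} [NeZero n] (hn : 3 ≤ n) (μ : Fin n → ℝ) (hμ : ∀ i, 0 < μ i)
    (i : Fin n) :
    wL μ i = dCoef μ i * ((∏ j, (μ j + μ (j + 1))) / ((μ i + μ (i + 1)) * (μ (i - 1) + μ i))) := by
  have h1 : (1 : Fin n) ≠ 0 := by
    intro h
    have := congrArg Fin.val h
    rw [Fin.val_one', Nat.mod_eq_of_lt (by omega)] at this
    simp at this
  have hne : i - 1 ≠ i := by
    intro h
    exact h1 (by simpa using h)
  have hs : Finset.univ.filter (fun j => j ≠ i ∧ j ≠ i - 1)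
      = (Finset.univ.erase i).erase (i - 1) := by
    ext j
    simp [and_comm]
  have hp := Finset.mul_prod_erase Finset.univ (fun j => μ j + μ (j + 1)) (Finset.mem_univ i)
  have hq := Finset.mul_prod_erase (Finset.univ.erase i) (fun j => μ j + μ (j + 1))
    (a := i - 1) (by simp [hne])
  simp only [sub_add_cancel] at hp hq
  have e1 := hμ i
  have e2 := hμ (i + 1)
  have e3 := hμ (i - 1)
  unfold wL
  rw [hs, ← hp, ← hq]
  field_simp

/-- `w_L` is a left null vector of the Laplacian `L_p = I - A`. -/
theorem wL_left_null_vector (n : ℕ) [NeZero n] (hn : 3 ≤ n)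
    (μ : Fin n → ℝ) (hμ : ∀ i, 0 < μ i) :
    ∀ j, ∑ i, wL μ i * (1 - Amat μ) i j = 0 := by
  intro j
  have h2 : (1 : Fin n) + 1 ≠ 0 := by
    intro h
    have := congrArg Fin.val h
    rw [Fin.val_add, Fin.val_one', Nat.mod_eq_of_lt (show 1 < n by omega),
      Nat.mod_eq_of_lt (show 1 + 1 < n by omega)] at this
    simp at this
  have key : ∀ i, wL μ i * (1 - Amat μ) i j =
      (if i = j then wL μ j else 0)
      - (if i = j - 1 then (∏ k, (μ k + μ (k + 1))) / (μ (j - 1) + μ j) else 0)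
      - (if i = j + 1 then (∏ k, (μ k + μ (k + 1))) / (μ j + μ (j + 1)) else 0) := by
    intro i
    have e1 := hμ i
    have e2 := hμ (i + 1)
    have e3 := hμ (i - 1)
    have hd : 0 < dCoef μ i := by unfold dCoef; positivity
    have hA : wL μ i * Amat μ i j =
      (if i = j - 1 then (∏ k, (μ k + μ (k + 1))) / (μ (j - 1) + μ j) else 0)
      + (if i = j + 1 then (∏ k, (μ k + μ (k + 1))) / (μ j + μ (j + 1)) else 0) := by
      rw [wL_eq_aux hn μ hμ]
      simp only [Amat, Matrix.of_apply]
      by_cases ha : j = i + 1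
      · subst ha
        have hne : i ≠ i + 1 + 1 := by
          intro h
          rw [add_assoc] at h
          exact h2 (by simpa using h)
        rw [if_pos rfl, if_pos (by simp), if_neg hne, add_sub_cancel_right]
        field_simp
        simp
      · have ha2 : i ≠ j - 1 := fun h => ha (by simp [h])
        rw [if_neg ha, if_neg ha2]
        by_cases hb : j = i - 1
        · subst hb
          rw [if_pos rfl, if_pos (by simp), sub_add_cancel]
          field_simp
          simp
        · have hb2 : i ≠ j + 1 := fun h => hb (by simp [h])
          rw [if_neg hb, if_neg hb2]
          simp
    rw [Matrix.sub_apply, mul_sub, hA, Matrix.one_apply]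
    by_cases hij : i = j
    · subst hij
      simp only [if_true]
      ring
    · simp only [hij, if_false]
      ring
  simp only [key, Finset.sum_sub_distrib, Finset.sum_ite_eq', Finset.sum_ite_eq, Finset.mem_univ, if_true]
  rw [wL_eq_aux hn μ hμ]
  have e1 := hμ j
  have e2 := hμ (j + 1)
  have e3 := hμ (j - 1)
  unfold dCoef
  field_simp
  ring
end

section
/- Fix n ≥ 3 and μ : Fin n → ℝ with μ_i > 0 for all i. Define w_L ∈ ℝⁿ by (w_L)_i = d_i · ∏_{j ≠ i, j ≠ i⁻} (μ_j + μ_{j⁺}), and define b ∈ ℝⁿ by b_1 = −2π(μ_1+μ_2)/(μ_2+2μ_1+μ_n), b_n = 2π(μ_{n−1}+μ_n)/(μ_1+2μ_n+μ_{n−1}), and b_i = 0 for 1 < i < n. Then w_Lᵀ·b = 0, i.e., Σ_i (w_L)_i · b_i = 0. -/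
open Matrix Filter Real

/-- The left null vector `w_L` is orthogonal to the offset vector `b`. -/
theorem wL_orthogonal_bVec (n : ℕ) [NeZero n] (hn : 3 ≤ n)
    (μ : Fin n → ℝ) (hμ : ∀ i, 0 < μ i) :
    ∑ i, wL μ i * bVec μ i = 0 := by
  have hd : ∀ i, dCoef μ i ≠ 0 := fun i => by
    have h1 := hμ (i + 1)
    have h2 := hμ i
    have h3 := hμ (i - 1)
    unfold dCoef
    positivity
  have h10 : (1 : Fin n) ≠ 0 := by
    intro h
    have := congrArg Fin.val h
    rw [Fin.val_one', Fin.val_zero, Nat.mod_eq_of_lt (by omega)] at this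
    omega
  have hm : (-1 : Fin n) ≠ 0 := neg_ne_zero.mpr h10
  have hm2 : (-1 - 1 : Fin n) ≠ -1 := fun h => h10 (sub_eq_self.mp h)
  have key : ∀ a : Fin n, a ≠ -1 →
      (μ a + μ (a + 1)) *
        ∏ j ∈ Finset.univ.filter (fun j => j ≠ a ∧ j ≠ -1), (μ j + μ (j + 1))
      = ∏ j ∈ Finset.univ.filter (fun j : Fin n => j ≠ -1), (μ j + μ (j + 1)) := by
    intro a ha
    rw [← Finset.mul_prod_erase (Finset.univ.filter (fun j : Fin n => j ≠ -1)) _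
      (a := a) (by simpa using ha)]
    congr 2
    ext j
    simp
  have k0 := key 0 hm.symm
  have k1 := key (-1 - 1) hm2
  rw [sub_add_cancel] at k1
  rw [zero_add] at k0
  have hs : (Finset.univ.filter (fun j : Fin n => j ≠ -1 ∧ j ≠ -1 - 1))
      = Finset.univ.filter (fun j : Fin n => j ≠ -1 - 1 ∧ j ≠ -1) := by
    ext j
    simp [and_comm]
  have e0 : wL μ 0 * bVec μ 0 = -(2 * Real.pi) *
      ∏ j ∈ Finset.univ.filter (fun j : Fin n => j ≠ -1), (μ j + μ (j + 1)) := by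
    rw [← k0, wL, bVec, if_pos rfl, zero_sub]
    have := hd 0
    field_simp
  have e1 : wL μ (-1) * bVec μ (-1) = (2 * Real.pi) *
      ∏ j ∈ Finset.univ.filter (fun j : Fin n => j ≠ -1), (μ j + μ (j + 1)) := by
    rw [← k1, wL, bVec, if_neg hm, if_pos rfl, hs]
    have := hd (-1)
    field_simp
  rw [Fintype.sum_eq_add 0 (-1) hm.symm, e0, e1]
  · ring
  · rintro x ⟨hx0, hx1⟩
    rw [bVec, if_neg hx0, if_neg hx1, mul_zero]
end

section
/- Fix n ≥ 3, μ : Fin n → ℝ with μ_i > 0 for all i, and a gain k_φ > 0. Let A be the matrix with A_{i,i⁺} = (μ_{i⁻}+μ_i)/d_i, A_{i,i⁻} = (μ_i+μ_{i⁺})/d_i and A_{i,j} = 0 otherwise, let L_p = I − A, and define w_L ∈ ℝⁿ by (w_L)_i = d_i · ∏_{j ≠ i, j ≠ i⁻} (μ_j + μ_{j⁺}). Suppose e : ℝ → ℝⁿ is differentiable with e'(t) = −k_φ · L_p · e(t) for all t, and suppose Σ_i (w_L)_i · e_i(0) = 0. Then e converges to zero exponentially: there exist constants C ≥ 0 and α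 > 0 such that ‖e(t)‖ ≤ C·exp(−α·t) for all t ≥ 0. -/
open Matrix Filter Real

lemma aux_ne {n : ℕ} [NeZero n] (hn : 3 ≤ n) (i : Fin n) :
    i ≠ i - 1 ∧ i + 1 ≠ i - 1 ∧ i ≠ i + 1 := by
  have h1 : (1 : Fin n) ≠ 0 := by
    intro h
    have := congrArg Fin.val h
    rw [Fin.val_one', Fin.val_zero, Nat.mod_eq_of_lt (by omega)] at this
    omega
  have h2 : (1 : Fin n) + 1 ≠ 0 := by
    intro h
    have := congrArg Fin.val h
    rw [Fin.val_add, Fin.val_one', Fin.val_zero, Nat.mod_eq_of_lt (by omega : 1 < n),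
      Nat.mod_eq_of_lt (by omega)] at this
    omega
  refine ⟨?_, ?_, ?_⟩
  · intro h
    exact h1 (by simpa using h.symm)
  · intro h
    apply h2
    rw [eq_sub_iff_add_eq, add_assoc] at h
    simpa using h
  · intro h
    exact h1 (by simpa using h.symm)

lemma aux_mulVec {n : ℕ} [NeZero n] (hn : 3 ≤ n) (μ : Fin n → ℝ) (x : Fin n → ℝ) (i : Fin n) :
    ((1 - Amat μ).mulVec x) i = x i - ((μ (i - 1) + μ i) / dCoef μ i * x (i + 1)
      + (μ i + μ (i + 1)) / dCoef μ i * x (i - 1)) := by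
  obtain ⟨h1, h2, h3⟩ := aux_ne hn i
  rw [Matrix.sub_mulVec, Pi.sub_apply, Matrix.one_mulVec]
  congr 1
  have : ∀ j, Amat μ i j * x j = (if j = i + 1 then (μ (i - 1) + μ i) / dCoef μ i * x (i + 1) else 0)
      + (if j = i - 1 then (μ i + μ (i + 1)) / dCoef μ i * x (i - 1) else 0) := by
    intro j
    simp only [Amat, Matrix.of_apply]
    by_cases ha : j = i + 1
    · subst ha
      simp [h2]
    · by_cases hb : j = i - 1
      · subst hb
        simp [h2.symm]
      · simp [ha, hb]
  simp only [Matrix.mulVec, dotProduct, this, Finset.sum_add_distrib]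
  simp

lemma aux_struct {n : ℕ} [NeZero n] (hn : 3 ≤ n) (μ : Fin n → ℝ) (hμ : ∀ i, 0 < μ i) :
    ∃ a : Fin n → ℝ, (∀ i, 0 < a i) ∧ (∀ i, 0 < wL μ i) ∧ ∀ (x : Fin n → ℝ) (i : Fin n),
      wL μ i * ((1 - Amat μ).mulVec x) i
        = a i * (x i - x (i + 1)) + a (i - 1) * (x i - x (i - 1)) := by
  have hc : ∀ i, 0 < μ i + μ (i + 1) := fun i => add_pos (hμ _) (hμ _)
  have hd : ∀ i, 0 < dCoef μ i := fun i => by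
    have := hμ i
    have := hμ (i + 1)
    have := hμ (i - 1)
    unfold dCoef
    linarith
  refine ⟨fun i => (∏ j, (μ j + μ (j + 1))) / (μ i + μ (i + 1)), ?_, ?_, ?_⟩
  · intro i
    exact div_pos (Finset.prod_pos fun j _ => hc j) (hc i)
  · intro i
    exact mul_pos (hd i) (Finset.prod_pos fun j _ => hc j)
  · intro x i
    obtain ⟨h1, h2, h3⟩ := aux_ne hn i
    have hP : (∏ j, (μ j + μ (j + 1))) = (μ i + μ (i + 1)) * ((μ (i - 1) + μ i) *
        ∏ j ∈ Finset.univ.filter (fun j => j ≠ i ∧ j ≠ i - 1), (μ j + μ (j + 1))) := by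
      rw [← Finset.mul_prod_erase Finset.univ _ (Finset.mem_univ i),
        ← Finset.mul_prod_erase (Finset.univ.erase i) _ (a := i - 1) (by simp [h1.symm]),
        sub_add_cancel]
      congr 2
      apply Finset.prod_congr _ (fun _ _ => rfl)
      ext j
      simp [and_comm]
    rw [aux_mulVec hn]
    simp only [wL, hP, sub_add_cancel]
    generalize (∏ j ∈ Finset.univ.filter (fun j => j ≠ i ∧ j ≠ i - 1), (μ j + μ (j + 1))) = R
    have e1 := (hc i).ne'
    have e2 := (hc (i - 1)).ne'
    rw [sub_add_cancel] at e2
    have e3 := (hd i).ne'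
    have e4 : dCoef μ i = (μ i + μ (i + 1)) + (μ (i - 1) + μ i) := by
      unfold dCoef
      ring
    field_simp
    rw [e4]
    ring

lemma aux_sum {n : ℕ} [NeZero n] (a x y : Fin n → ℝ) :
    ∑ i, y i * (a i * (x i - x (i + 1)) + a (i - 1) * (x i - x (i - 1)))
      = ∑ i, a i * ((x i - x (i + 1)) * (y i - y (i + 1))) := by
  have h : ∑ i, y i * (a (i - 1) * (x i - x (i - 1)))
      = ∑ i, y (i + 1) * (a i * (x (i + 1) - x i)) := by
    rw [← Equiv.sum_comp (Equiv.addRight (1 : Fin n))]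
    simp
  simp only [mul_add, Finset.sum_add_distrib] at *
  rw [h, ← Finset.sum_add_distrib]
  apply Finset.sum_congr rfl
  intro i _
  ring

lemma aux_path {n : ℕ} [NeZero n] (x : Fin n → ℝ) (m : ℝ)
    (h : ∀ i, |x i - x (i + 1)| ≤ m) (k : ℕ) : |x (Fin.ofNat n k) - x 0| ≤ k * m := by
  induction k with
  | zero => simp
  | succ k ih =>
    have e : Fin.ofNat n (k + 1) = Fin.ofNat n k + 1 := by
      ext
      simp [Fin.val_add]
    have := h (Fin.ofNat n k)
    rw [e]
    push_cast
    rw [abs_le] at *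
    constructor <;> linarith [this.1, this.2, ih.1, ih.2]

lemma aux_poincare {n : ℕ} [NeZero n] (a w : Fin n → ℝ) (ha : ∀ i, 0 < a i) (hw : ∀ i, 0 < w i) :
    ∃ K : ℝ, 0 < K ∧ ∀ x : Fin n → ℝ, ∑ i, w i * x i = 0 →
      K * ∑ i, w i * x i ^ 2 ≤ ∑ i, a i * ((x i - x (i + 1)) * (x i - x (i + 1))) := by
  obtain ⟨i0, hi0⟩ := Finite.exists_min a
  have hn : (0 : ℝ) < n := by exact_mod_cast Nat.pos_of_ne_zero (NeZero.ne n)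
  have hW : 0 < ∑ i, w i := Finset.sum_pos (fun i _ => hw i) ⟨0, Finset.mem_univ _⟩
  refine ⟨a i0 / ((∑ i, w i) * (n : ℝ) ^ 2), by have := ha i0; positivity, ?_⟩
  intro x hx
  set Q := ∑ i, a i * ((x i - x (i + 1)) * (x i - x (i + 1))) with hQ
  have hQi : ∀ i, a i0 * (x i - x (i + 1)) ^ 2 ≤ Q := by
    intro i
    calc a i0 * (x i - x (i + 1)) ^ 2 ≤ a i * ((x i - x (i + 1)) * (x i - x (i + 1))) := by
          rw [pow_two]
          exact mul_le_mul_of_nonneg_right (hi0 i) (mul_self_nonneg _)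
      _ ≤ Q := Finset.single_le_sum
          (f := fun i => a i * ((x i - x (i + 1)) * (x i - x (i + 1))))
          (fun j _ => mul_nonneg (ha j).le (mul_self_nonneg _)) (Finset.mem_univ i)
  have hQ0 : 0 ≤ Q := Finset.sum_nonneg (fun j _ => mul_nonneg (ha j).le (mul_self_nonneg _))
  have hm : ∀ i, |x i - x (i + 1)| ≤ √(Q / a i0) := by
    intro i
    apply Real.abs_le_sqrt
    rw [le_div_iff₀ (ha i0)]
    linarith [hQi i]
  have hb : ∀ i, (x i - x 0) ^ 2 ≤ (n : ℝ) ^ 2 * (Q / a i0) := by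
    intro i
    have h1 := aux_path x _ hm i.val
    have e : Fin.ofNat n i.val = i := by
      ext
      simp
    rw [e] at h1
    have h2 : |x i - x 0| ≤ n * √(Q / a i0) :=
      h1.trans (mul_le_mul_of_nonneg_right (by exact_mod_cast i.isLt.le) (Real.sqrt_nonneg _))
    have h3 := pow_le_pow_left₀ (abs_nonneg _) h2 2
    rwa [sq_abs, mul_pow, Real.sq_sqrt (div_nonneg hQ0 (ha i0).le)] at h3
  have hs : ∑ i, w i * (x i - x 0) ^ 2 = ∑ i, w i * x i ^ 2 + (∑ i, w i) * x 0 ^ 2 := by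
    have : ∀ i, w i * (x i - x 0) ^ 2 = w i * x i ^ 2 - 2 * x 0 * (w i * x i) + w i * x 0 ^ 2 :=
      fun i => by ring
    simp only [this, Finset.sum_add_distrib, Finset.sum_sub_distrib, ← Finset.mul_sum, hx,
      ← Finset.sum_mul]
    ring
  have hs2 : ∑ i, w i * (x i - x 0) ^ 2 ≤ (∑ i, w i) * ((n : ℝ) ^ 2 * (Q / a i0)) := by
    rw [Finset.sum_mul]
    exact Finset.sum_le_sum fun i _ => mul_le_mul_of_nonneg_left (hb i) (hw i).le
  have hs3 : ∑ i, w i * x i ^ 2 ≤ (∑ i, w i) * ((n : ℝ) ^ 2 * (Q / a i0)) := by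
    have : 0 ≤ (∑ i, w i) * x 0 ^ 2 := by positivity
    linarith
  have hA := ha i0
  calc a i0 / ((∑ i, w i) * (n : ℝ) ^ 2) * ∑ i, w i * x i ^ 2
      ≤ a i0 / ((∑ i, w i) * (n : ℝ) ^ 2) * ((∑ i, w i) * ((n : ℝ) ^ 2 * (Q / a i0))) :=
        mul_le_mul_of_nonneg_left hs3 (by positivity)
    _ = Q := by
        field_simp

/-- If `e' = -k_φ L_p e` and `w_Lᵀ e(0) = 0`, then `e` converges to zero
exponentially. -/
theorem error_exponential_convergence (n : ℕ) [NeZero n] (hn : 3 ≤ n)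
    (μ : Fin n → ℝ) (hμ : ∀ i, 0 < μ i)
    (kφ : ℝ) (hkφ : 0 < kφ)
    (e : ℝ → Fin n → ℝ)
    (he : ∀ (t : ℝ) (i : Fin n), HasDerivAt (fun s => e s i)
      (-kφ * (((1 - Amat μ).mulVec (e t)) i)) t)
    (h0 : ∑ i, wL μ i * e 0 i = 0) :
    ∃ C α : ℝ, 0 ≤ C ∧ 0 < α ∧ ∀ t : ℝ, 0 ≤ t → ‖e t‖ ≤ C * Real.exp (-α * t) := by
  obtain ⟨a, ha, hw, hL⟩ := aux_struct hn μ hμ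
  obtain ⟨K, hK, hP⟩ := aux_poincare a (wL μ) ha hw
  -- conservation of the weighted mean
  have hcons : ∀ t, ∑ i, wL μ i * e t i = 0 := by
    have hder : ∀ t, HasDerivAt (fun s => ∑ i, wL μ i * e s i) 0 t := by
      intro t
      have h := HasDerivAt.fun_sum (u := Finset.univ)
        (fun i _ => (he t i).const_mul (wL μ i))
      refine h.congr_deriv ?_
      have h1 := aux_sum a (e t) (fun _ => 1)
      simp only [sub_self, mul_zero, Finset.sum_const_zero, one_mul, ← hL] at h1
      simp only [mul_left_comm _ (-kφ), ← Finset.mul_sum, h1, mul_zero]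
    intro t
    rw [← h0]
    exact is_const_of_deriv_eq_zero (fun t => (hder t).differentiableAt)
      (fun t => (hder t).deriv) t 0
  have hVd : ∀ t, HasDerivAt (fun s => ∑ i, wL μ i * e s i ^ 2)
      (-(2 * kφ) * ∑ i, a i * ((e t i - e t (i + 1)) * (e t i - e t (i + 1)))) t := by
    intro t
    have h := HasDerivAt.fun_sum (u := Finset.univ)
      (fun i _ => ((he t i).fun_pow 2).const_mul (wL μ i))
    refine h.congr_deriv ?_
    rw [← aux_sum a (e t) (e t), Finset.mul_sum]
    apply Finset.sum_congr rfl
    intro i _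
    rw [← hL]
    push_cast
    ring
  set V : ℝ → ℝ := fun s => ∑ i, wL μ i * e s i ^ 2 with hV
  have hV0 : ∀ t, 0 ≤ V t := fun t =>
    Finset.sum_nonneg fun i _ => mul_nonneg (hw i).le (sq_nonneg _)
  have hGd : ∀ t, HasDerivAt (fun s => V s * Real.exp (2 * (kφ * K) * s))
      ((-(2 * kφ) * ∑ i, a i * ((e t i - e t (i + 1)) * (e t i - e t (i + 1))))
        * Real.exp (2 * (kφ * K) * t)
        + V t * (Real.exp (2 * (kφ * K) * t) * (2 * (kφ * K) * 1))) t := fun t =>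
    (hVd t).mul (((hasDerivAt_id t).const_mul (2 * (kφ * K))).exp)
  have hanti : Antitone (fun s => V s * Real.exp (2 * (kφ * K) * s)) := by
    apply antitone_of_deriv_nonpos (fun t => (hGd t).differentiableAt)
    intro t
    rw [(hGd t).deriv]
    have h1 := hP (e t) (hcons t)
    have h2 : 0 ≤ 2 * kφ * Real.exp (2 * (kφ * K) * t) := by positivity
    have h3 := mul_le_mul_of_nonneg_left h1 h2
    simp only [hV]
    linarith
  obtain ⟨i0, hi0⟩ := Finite.exists_min (wL μ)
  have hv := hw i0
  refine ⟨√(V 0 / wL μ i0), kφ * K, Real.sqrt_nonneg _, mul_pos hkφ hK, ?_⟩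
  intro t ht
  rw [pi_norm_le_iff_of_nonneg (by positivity)]
  intro i
  rw [Real.norm_eq_abs]
  apply abs_le_of_sq_le_sq _ (by positivity)
  rw [mul_pow, Real.sq_sqrt (div_nonneg (hV0 0) hv.le), ← Real.exp_nat_mul]
  have h1 : V t * Real.exp (2 * (kφ * K) * t) ≤ V 0 := by
    simpa using hanti ht
  have h2 : wL μ i0 * e t i ^ 2 ≤ V t :=
    (mul_le_mul_of_nonneg_right (hi0 i) (sq_nonneg _)).trans
      (Finset.single_le_sum (f := fun i => wL μ i * e t i ^ 2)
        (fun j _ => mul_nonneg (hw j).le (sq_nonneg _)) (Finset.mem_univ i))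
  have h3 : V t ≤ V 0 * Real.exp (((2 : ℕ) : ℝ) * (-(kφ * K) * t)) := by
    have e1 : ((2 : ℕ) : ℝ) * (-(kφ * K) * t) = -(2 * (kφ * K) * t) := by
      push_cast
      ring
    rw [e1, Real.exp_neg, ← div_eq_mul_inv, le_div_iff₀ (Real.exp_pos _)]
    exact h1
  rw [div_mul_eq_mul_div, le_div_iff₀ hv]
  linarith
end

section
/- (Theorem 1, angular part.) Fix n ≥ 3, μ : Fin n → ℝ with μ_i > 0 for all i, a gain k_φ > 0 and ω* ∈ ℝ. Let A be the matrix with A_{i,i⁺} = (μ_{i⁻}+μ_i)/d_i, A_{i,i⁻} = (μ_i+μ_{i⁺})/d_i and A_{i,j} = 0 otherwise, and let b ∈ ℝⁿ have b_1 = −2π(μ_1+μ_2)/d_1, b_n = 2π(μ_{n−1}+μ_n)/d_n and b_i = 0 otherwise. Suppose φ : ℝ → ℝⁿ is differentiable and satisfies φ'(t) = ω*·𝟏 + k_φ·(A·φ(t) + b − φ(t)) for all t. Define the spacings Δ_i(t) = φ_{i+1}(t) − φ_i(t) for i = 1,…,n−1 and Δ_n(t) = φ_1(t) − φ_n(t)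 + 2π. Then, as t → ∞: (i) φ_i'(t) → ω* for every i, and (ii) Δ_i(t) → (μ_i + μ_{i⁺})·π / (Σ_{k=1}^n μ_k) for every i. -/
open Matrix Filter Real

lemma shift_sum {n : ℕ} [NeZero n] (f : Fin n → ℝ) : ∑ i, f (i + 1) = ∑ i, f i :=
  Equiv.sum_comp (Equiv.addRight (1 : Fin n)) f

lemma cyc_dist {n : ℕ} [NeZero n] (y : Fin n → ℝ) (e : ℝ)
    (h : ∀ i, |y (i + 1) - y i| ≤ e) (m : ℕ) (hm : m < n) :
    |y ⟨m, hm⟩ - y 0| ≤ m * e := by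
  induction m with
  | zero =>
    have : (⟨0, hm⟩ : Fin n) = 0 := by ext; simp
    simp [this]
  | succ k ih =>
    have hk : k < n := by omega
    have h1 : (⟨k + 1, hm⟩ : Fin n) = ⟨k, hk⟩ + 1 := by
      ext
      simp [Fin.val_add, Nat.mod_eq_of_lt hm]
    have h2 := ih hk
    have h3 := h ⟨k, hk⟩
    rw [h1]
    have h4 := abs_add_le (y (⟨k, hk⟩ + 1) - y ⟨k, hk⟩) (y ⟨k, hk⟩ - y 0)
    rw [sub_add_sub_cancel] at h4
    push_cast
    linarith

lemma poincare {n : ℕ} [NeZero n] (s c : Fin n → ℝ) (hs : ∀ i, 0 < s i) (hc : ∀ i, 0 < c i) :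
    ∃ l : ℝ, 0 < l ∧ ∀ y : Fin n → ℝ, ∑ i, s i * y i = 0 →
      l * ∑ i, s i * y i ^ 2 ≤ ∑ i, c i * (y (i + 1) - y i) ^ 2 := by
  obtain ⟨i0, hi0⟩ := Finite.exists_min c
  have hn : (0 : ℝ) < n := by exact_mod_cast Nat.pos_of_ne_zero (NeZero.ne n)
  have hS : 0 < ∑ i, s i := Finset.sum_pos (fun i _ => hs i) ⟨0, Finset.mem_univ _⟩
  set S := ∑ i, s i with hSd
  refine ⟨c i0 / (S * (2 * n) ^ 2), by have := hc i0; positivity, fun y hy => ?_⟩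
  set E := ∑ i, (y (i + 1) - y i) ^ 2 with hE
  have hE0 : 0 ≤ E := Finset.sum_nonneg fun i _ => sq_nonneg _
  have hd : ∀ i, |y (i + 1) - y i| ≤ √E := fun i => by
    apply Real.abs_le_sqrt
    exact Finset.single_le_sum (f := fun i => (y (i + 1) - y i) ^ 2)
      (fun i _ => sq_nonneg _) (Finset.mem_univ i)
  have h0 : ∀ i, |y i - y 0| ≤ n * √E := fun i => by
    have h1 := cyc_dist y _ hd i.1 i.2
    have h2 : ((i.1 : ℕ) : ℝ) ≤ n := by exact_mod_cast i.2.le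
    have h3 := mul_le_mul_of_nonneg_right h2 (Real.sqrt_nonneg E)
    exact h1.trans h3
  have hij : ∀ i j, |y i - y j| ≤ 2 * n * √E := fun i j => by
    have h1 := abs_sub_le (y i) (y 0) (y j)
    have h2 := h0 j
    rw [abs_sub_comm] at h2
    linarith [h0 i]
  have hyi : ∀ i, |y i| ≤ 2 * n * √E := fun i => by
    have h1 : S * y i = ∑ j, s j * (y i - y j) := by
      simp only [mul_sub, Finset.sum_sub_distrib, hy, ← Finset.sum_mul, hSd]
      ring
    have h2 : S * |y i| ≤ S * (2 * n * √E) := by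
      rw [← abs_of_pos hS, ← abs_mul, h1, abs_of_pos hS, hSd, Finset.sum_mul]
      refine (Finset.abs_sum_le_sum_abs _ _).trans (Finset.sum_le_sum fun j _ => ?_)
      rw [abs_mul, abs_of_pos (hs j)]
      exact mul_le_mul_of_nonneg_left (hij i j) (hs j).le
    exact le_of_mul_le_mul_left h2 hS
  have hsq : ∀ i, y i ^ 2 ≤ (2 * n) ^ 2 * E := fun i => by
    have h1 := pow_le_pow_left₀ (abs_nonneg _) (hyi i) 2
    rw [sq_abs, mul_pow, Real.sq_sqrt hE0] at h1
    exact h1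
  have hV : ∑ i, s i * y i ^ 2 ≤ S * (2 * n) ^ 2 * E := by
    rw [mul_assoc, hSd, Finset.sum_mul]
    exact Finset.sum_le_sum fun i _ => mul_le_mul_of_nonneg_left (hsq i) (hs i).le
  have hcE : c i0 * E ≤ ∑ i, c i * (y (i + 1) - y i) ^ 2 := by
    rw [hE, Finset.mul_sum]
    exact Finset.sum_le_sum fun i _ => mul_le_mul_of_nonneg_right (hi0 i) (sq_nonneg _)
  refine le_trans ?_ hcE
  rw [div_mul_eq_mul_div, div_le_iff₀ (by positivity)]
  have := mul_le_mul_of_nonneg_left hV (hc i0).le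
  linarith

/-- Weighted heat flow on the cycle converges to zero when the weighted mean vanishes. -/
lemma flow_tendsto {n : ℕ} [NeZero n] (s c : Fin n → ℝ) (hs : ∀ i, 0 < s i) (hc : ∀ i, 0 < c i)
    (y : ℝ → Fin n → ℝ) (hy0 : ∀ t, ∑ i, s i * y t i = 0)
    (hy : ∀ t i, HasDerivAt (fun r => y r i)
      ((c i * (y t (i + 1) - y t i) - c (i - 1) * (y t i - y t (i - 1))) / s i) t) (i : Fin n) :
    Tendsto (fun t => y t i) atTop (nhds 0) := by
  obtain ⟨l, hl, hP⟩ := poincare s c hs hc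
  set V : ℝ → ℝ := fun t => ∑ i, s i * y t i ^ 2 with hVd
  have hV : ∀ t, HasDerivAt V (-2 * ∑ i, c i * (y t (i + 1) - y t i) ^ 2) t := fun t => by
    have h1 : HasDerivAt V (∑ i, s i * (2 * y t i *
        ((c i * (y t (i + 1) - y t i) - c (i - 1) * (y t i - y t (i - 1))) / s i))) t := by
      refine HasDerivAt.fun_sum fun i _ => HasDerivAt.const_mul _ ?_
      simpa using (hy t i).fun_pow 2
    convert h1 using 1
    have h2 : ∀ i, s i * (2 * y t i *
        ((c i * (y t (i + 1) - y t i) - c (i - 1) * (y t i - y t (i - 1))) / s i))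
        = 2 * (y t i * (c i * (y t (i + 1) - y t i)))
          - 2 * (y t i * (c (i - 1) * (y t i - y t (i - 1)))) := fun i => by
      have := (hs i).ne'
      field_simp
    rw [Finset.sum_congr rfl fun i _ => h2 i, Finset.sum_sub_distrib,
      ← shift_sum (fun i => 2 * (y t i * (c (i - 1) * (y t i - y t (i - 1))))),
      ← Finset.sum_sub_distrib, Finset.mul_sum]
    refine Finset.sum_congr rfl fun i _ => ?_
    simp only [add_sub_cancel_right]
    ring
  have hW : ∀ t, HasDerivAt (fun t => V t * Real.exp (2 * l * t))
      ((-2 * ∑ i, c i * (y t (i + 1) - y t i) ^ 2) * Real.exp (2 * l * t)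
        + V t * (Real.exp (2 * l * t) * (2 * l))) t := fun t => by
    refine (hV t).mul ?_
    simpa using ((hasDerivAt_id t).const_mul (2 * l)).exp
  have hanti : Antitone (fun t => V t * Real.exp (2 * l * t)) := by
    refine antitone_of_deriv_nonpos (fun t => (hW t).differentiableAt) fun t => ?_
    rw [(hW t).deriv]
    have h1 := hP (y t) (hy0 t)
    have h2 := Real.exp_pos (2 * l * t)
    have h3 : (2 * (l * V t - ∑ i, c i * (y t (i + 1) - y t i) ^ 2)) * Real.exp (2 * l * t) ≤ 0 :=
      mul_nonpos_of_nonpos_of_nonneg (by simp only [hVd]; linarith) h2.le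
    linarith
  have hb : ∀ᶠ t in atTop, y t i ^ 2 ≤ V 0 / s i * Real.exp (-(2 * l * t)) := by
    filter_upwards [eventually_ge_atTop 0] with t ht
    have h1 := hanti ht
    simp only [mul_zero, Real.exp_zero, mul_one] at h1
    have h2 : s i * y t i ^ 2 ≤ V t :=
      Finset.single_le_sum (f := fun i => s i * y t i ^ 2)
        (fun i _ => mul_nonneg (hs i).le (sq_nonneg _)) (Finset.mem_univ i)
    rw [Real.exp_neg, ← div_eq_mul_inv, le_div_iff₀ (Real.exp_pos _), le_div_iff₀ (hs i)]
    have := mul_le_mul_of_nonneg_right h2 (Real.exp_pos (2 * l * t)).le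
    linarith
  have hlim : Tendsto (fun t => V 0 / s i * Real.exp (-(2 * l * t))) atTop (nhds 0) := by
    have h1 : Tendsto (fun t : ℝ => 2 * l * t) atTop atTop :=
      tendsto_id.const_mul_atTop (by positivity)
    simpa using (Real.tendsto_exp_neg_atTop_nhds_zero.comp h1).const_mul (V 0 / s i)
  have hsq : Tendsto (fun t => y t i ^ 2) atTop (nhds 0) :=
    tendsto_of_tendsto_of_tendsto_of_le_of_le' tendsto_const_nhds hlim
      (Eventually.of_forall fun t => sq_nonneg _) hb
  have h3 := hsq.sqrt
  simp only [Real.sqrt_sq_eq_abs, Real.sqrt_zero] at h3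
  exact (tendsto_zero_iff_abs_tendsto_zero _).2 h3

/-- Theorem 1 (angular part): under the distributed angular control law
`φ' = ω* 1 + k_φ (A φ + b - φ)`, the angular speeds converge to `ω*` and the
spacings `Δᵢ` converge to `(μᵢ + μᵢ₊) π / Σ μₖ` (Formation Guideline 1). -/
theorem angular_convergence (n : ℕ) [NeZero n] (hn : 3 ≤ n)
    (μ : Fin n → ℝ) (hμ : ∀ i, 0 < μ i)
    (kφ ωstar : ℝ) (hkφ : 0 < kφ)
    (φ : ℝ → Fin n → ℝ)
    (hφ : ∀ (t : ℝ) (i : Fin n), HasDerivAt (fun s => φ s i)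
      (ωstar + kφ * (((Amat μ).mulVec (φ t) + bVec μ - φ t) i)) t)
    (Δ : ℝ → Fin n → ℝ)
    (hΔ : ∀ (t : ℝ) (i : Fin n),
      Δ t i = φ t (i + 1) - φ t i + (if i = -1 then 2 * Real.pi else 0)) :
    (∀ i : Fin n, Tendsto (fun t => deriv (fun s => φ s i) t) atTop (nhds ωstar)) ∧
    (∀ i : Fin n, Tendsto (fun t => Δ t i) atTop
      (nhds ((μ i + μ (i + 1)) * Real.pi / ∑ k, μ k))) := by
  have hne : ∀ i : Fin n, i + 1 ≠ i - 1 := fun i h => by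
    have h1 : (1 : Fin n) + 1 = 0 := by
      have h2 : i + (1 + 1) = i + 0 := by
        rw [← add_assoc, h]; simp
      exact add_left_cancel h2
    have h3 := congrArg Fin.val h1
    have h4 : 1 % n = 1 := Nat.mod_eq_of_lt (by omega)
    have h5 : 2 % n = 2 := Nat.mod_eq_of_lt (by omega)
    simp [Fin.val_add, h5] at h3
  have h01 : (0 : Fin n) ≠ -1 := fun h => by
    have h3 := congrArg (fun x => Fin.val (x + 1)) h
    have h4 : 1 % n = 1 := Nat.mod_eq_of_lt (by omega)
    simp [h4] at h3
  set s : Fin n → ℝ := fun i => μ i + μ (i + 1) with hsd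
  have hs : ∀ i, 0 < s i := fun i => add_pos (hμ _) (hμ _)
  have hd : ∀ i, 0 < dCoef μ i := fun i => by
    have := hμ i; have := hμ (i + 1); have := hμ (i - 1)
    unfold dCoef; positivity
  have hmul : ∀ t i, ((Amat μ).mulVec (φ t) + bVec μ - φ t) i
      = (s (i - 1) * Δ t i - s i * Δ t (i - 1)) / dCoef μ i := fun t i => by
    have hA : (Amat μ).mulVec (φ t) i = (μ (i - 1) + μ i) / dCoef μ i * φ t (i + 1)
        + (μ i + μ (i + 1)) / dCoef μ i * φ t (i - 1) := by
      have h1 : ∀ j, Amat μ i j * φ t j =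
          (if j = i + 1 then (μ (i - 1) + μ i) / dCoef μ i * φ t j else 0)
          + (if j = i - 1 then (μ i + μ (i + 1)) / dCoef μ i * φ t j else 0) := fun j => by
        simp only [Amat, Matrix.of_apply]
        by_cases hj : j = i + 1
        · simp [hj, hne i]
        · by_cases hj2 : j = i - 1
          · simp [hj2, (hne i).symm]
          · simp [hj, hj2]
      simp only [Matrix.mulVec, dotProduct]
      rw [Finset.sum_congr rfl fun j _ => h1 j, Finset.sum_add_distrib]
      simp
    simp only [Pi.add_apply, Pi.sub_apply, hA, hΔ, hsd, sub_add_cancel]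
    have hd0 := (hd i).ne'
    have hdd : dCoef μ i = μ (i + 1) + 2 * μ i + μ (i - 1) := rfl
    have hi1 : (i - 1 = -1) ↔ i = 0 := by
      rw [sub_eq_iff_eq_add]; simp
    simp only [hi1]
    by_cases hi : i = 0
    · subst hi
      simp only [bVec, h01, if_true, if_false, zero_add]
      rw [zero_add] at hdd
      field_simp
      rw [hdd]; ring
    · by_cases hi2 : i = -1
      · subst hi2
        simp only [bVec, h01.symm, if_true, if_false]
        field_simp
        rw [hdd]; ring
      · simp only [bVec, hi, hi2, if_false]
        field_simp
        rw [hdd]; ring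
  set xb : ℝ := Real.pi / ∑ k, μ k with hxb
  have hM : 0 < ∑ k, μ k := Finset.sum_pos (fun i _ => hμ i) ⟨0, Finset.mem_univ _⟩
  have hsS : ∑ i, s i = 2 * ∑ k, μ k := by
    simp only [hsd, Finset.sum_add_distrib, shift_sum μ]; ring
  have hΔS : ∀ t, ∑ i, Δ t i = 2 * Real.pi := fun t => by
    simp only [hΔ, Finset.sum_add_distrib, Finset.sum_sub_distrib, shift_sum (φ t)]
    simp
  set y : ℝ → Fin n → ℝ := fun t i => Δ t i / s i - xb with hyd
  have hΔy : ∀ t i, Δ t i = s i * (y t i + xb) := fun t i => by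
    have := (hs i).ne'
    simp only [hyd]; field_simp; ring
  set c : Fin n → ℝ := fun i => kφ * (s i * s (i + 1)) / dCoef μ (i + 1) with hcd
  have hc : ∀ i, 0 < c i := fun i => by
    have := hs i; have := hs (i + 1); have := hd (i + 1)
    simp only [hcd]; positivity
  have hφ' : ∀ t i, HasDerivAt (fun r => φ r i)
      (ωstar + c (i - 1) * (y t i - y t (i - 1))) t := fun t i => by
    convert hφ t i using 1
    rw [hmul, hΔy, hΔy]
    simp only [hcd, sub_add_cancel]
    ring
  have hy0 : ∀ t, ∑ i, s i * y t i = 0 := fun t => by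
    have h1 : ∀ i, s i * y t i = Δ t i - s i * xb := fun i => by rw [hΔy]; ring
    rw [Finset.sum_congr rfl fun i _ => h1 i, Finset.sum_sub_distrib, hΔS, ← Finset.sum_mul,
      hsS, hxb]
    field_simp
    ring
  have hy : ∀ t i, HasDerivAt (fun r => y r i)
      ((c i * (y t (i + 1) - y t i) - c (i - 1) * (y t i - y t (i - 1))) / s i) t := fun t i => by
    have h1 := (((((hφ' t (i + 1)).sub (hφ' t i)).add_const
      (if i = -1 then 2 * Real.pi else 0)).div_const (s i)).sub_const xb)
    have h2 : (fun r => y r i) = fun r => (φ r (i + 1) - φ r i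
        + (if i = -1 then 2 * Real.pi else 0)) / s i - xb := by
      funext r; simp only [hyd, hΔ]
    rw [h2]
    refine HasDerivAt.congr_deriv h1 ?_
    rw [show i + 1 - 1 = i from add_sub_cancel_right i 1]
    ring
  have hlim := flow_tendsto s c hs hc y hy0 hy
  refine ⟨fun i => ?_, fun i => ?_⟩
  · have h1 : (fun t => deriv (fun r => φ r i) t)
        = fun t => ωstar + c (i - 1) * (y t i - y t (i - 1)) := funext fun t => (hφ' t i).deriv
    rw [h1]
    simpa using (((hlim i).sub (hlim (i - 1))).const_mul (c (i - 1))).const_add ωstar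
  · have h1 : (fun t => Δ t i) = fun t => s i * (y t i + xb) := funext fun t => hΔy t i
    rw [h1]
    have h2 := ((hlim i).add_const xb).const_mul (s i)
    rw [zero_add] at h2
    rw [mul_div_assoc]
    exact h2
end

section
/- Fix n ≥ 2 and μ : Fin n → ℝ with μ_i > 0 for all i. Suppose Δ : Fin n → ℝ satisfies, for every i, the ratio relation (μ_i + μ_{i⁻})·Δ_i = (μ_i + μ_{i⁺})·Δ_{i⁻}, together with Σ_{i} Δ_i = 2π. Then Δ_i = (μ_i + μ_{i⁺})·π / (Σ_{k=1}^n μ_k) for every i. -/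
open Real

/-- Formation Guideline 1: if the spacings satisfy the cyclic ratio relation
`(μᵢ + μᵢ₋) Δᵢ = (μᵢ + μᵢ₊) Δᵢ₋` and sum to `2π`, then
`Δᵢ = (μᵢ + μᵢ₊) π / Σ μₖ`. -/
theorem guideline_one_spacing (n : ℕ) [NeZero n] (hn : 2 ≤ n)
    (μ Δ : Fin n → ℝ) (hμ : ∀ i, 0 < μ i)
    (hratio : ∀ i : Fin n, (μ i + μ (i - 1)) * Δ i = (μ i + μ (i + 1)) * Δ (i - 1))
    (hsum : ∑ i, Δ i = 2 * Real.pi) :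
    ∀ i : Fin n, Δ i = (μ i + μ (i + 1)) * Real.pi / ∑ k, μ k := by
  obtain ⟨m, rfl⟩ : ∃ m, n = m + 1 := ⟨n - 1, by omega⟩
  have hpos : ∀ i, 0 < μ i + μ (i + 1) := fun i => add_pos (hμ _) (hμ _)
  have key : ∀ i, Δ i = (μ i + μ (i + 1)) * (Δ 0 / (μ 0 + μ (0 + 1))) := by
    intro i
    induction i using Fin.induction with
    | zero =>
      have := (hpos 0).ne'
      field_simp
    | succ j ih =>
      have h1 : j.castSucc + 1 = j.succ := Fin.coeSucc_eq_succ
      have h2 : j.succ - 1 = j.castSucc := by rw [← h1, add_sub_cancel_right]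
      have h := hratio j.succ
      have hp := hpos j.castSucc
      rw [h2, ih, h1] at h
      rw [h1] at hp
      apply mul_left_cancel₀ hp.ne'
      linarith
  generalize Δ 0 / (μ 0 + μ (0 + 1)) = c at key
  have hshift : ∑ i, μ (i + 1) = ∑ i, μ i := Equiv.sum_comp (Equiv.addRight 1) μ
  have hS : 0 < ∑ k, μ k := Finset.sum_pos (fun i _ => hμ i) Finset.univ_nonempty
  rw [Finset.sum_congr rfl (fun i _ => key i), ← Finset.sum_mul, Finset.sum_add_distrib,
    hshift] at hsum
  intro i
  rw [key i, eq_div_iff hS.ne', mul_assoc]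
  congr 1
  linarith
end

section
/- Fix n ≥ 3, μ : Fin n → ℝ with μ_i > 0 for all i, a gain k_φ > 0 and ω* ∈ ℝ. Let A, b be as in the angular control law (A_{i,i⁺} = (μ_{i⁻}+μ_i)/d_i, A_{i,i⁻} = (μ_i+μ_{i⁺})/d_i, other entries 0; b_1 = −2π(μ_1+μ_2)/d_1, b_n = 2π(μ_{n−1}+μ_n)/d_n, other entries 0). Suppose φ : ℝ → ℝⁿ is differentiable with φ'(t) = ω*·𝟏 + k_φ·(A·φ(t) + b − φ(t)), and define Δ_i(t) = φ_{i+1}(t) − φ_i(t) for i = 1,…,n−1 and Δ_n(t) = φ_1(t) − φ_n(t) + 2π. Let M_Δ be the matrix with entries (M_Δ)_{i,i⁺} = (μ_i+μ_{i⁺})/d_{i⁺}, (M_Δ)_{i,i⁻} = (μ_i+μ_{i⁺})/d_i, (M_Δ)_{i,i} = −(μ_{i⁺}+μ_{i⁺⁺})/d_{i⁺} − (μ_{i⁻}+μ_i)/d_i, and all other entries 0. Then for every t, Δ'(t) = k_φ · M_Δ · Δ(t). -/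
open Matrix Filter Real

theorem aux_one_ne {n : ℕ} [NeZero n] (hn : 3 ≤ n) : (1 : Fin n) ≠ 0 := by
  intro h
  have := congrArg Fin.val h
  rw [Fin.val_one', Fin.val_zero, Nat.mod_eq_of_lt (by omega)] at this
  omega

theorem aux_two_ne {n : ℕ} [NeZero n] (hn : 3 ≤ n) : (1 + 1 : Fin n) ≠ 0 := by
  intro h
  have := congrArg Fin.val h
  rw [Fin.val_add, Fin.val_one', Fin.val_zero, Nat.mod_eq_of_lt (a := 1) (by omega),
    Nat.mod_eq_of_lt (by omega)] at this
  omega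

theorem aux_ne1 {n : ℕ} [NeZero n] (hn : 3 ≤ n) (i : Fin n) : i - 1 ≠ i + 1 := by
  intro h
  apply aux_two_ne hn
  have h2 : i + (1 + 1) = i + 0 := by
    rw [← add_assoc, ← h]; simp
  exact add_left_cancel h2

theorem aux_ne2 {n : ℕ} [NeZero n] (hn : 3 ≤ n) (i : Fin n) : i ≠ i + 1 := by
  intro h
  exact aux_one_ne hn (left_eq_add.mp h)

theorem aux_ne3 {n : ℕ} [NeZero n] (hn : 3 ≤ n) (i : Fin n) : i ≠ i - 1 := by
  intro h
  exact aux_one_ne hn (sub_eq_self.mp h.symm)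

theorem aux_A {n : ℕ} [NeZero n] (hn : 3 ≤ n) (μ v : Fin n → ℝ) (i : Fin n) :
    (Amat μ).mulVec v i = (μ (i - 1) + μ i) / dCoef μ i * v (i + 1)
      + (μ i + μ (i + 1)) / dCoef μ i * v (i - 1) := by
  have h1 := aux_ne1 hn i
  have key : ∀ j, Amat μ i j * v j =
      (if j = i + 1 then (μ (i - 1) + μ i) / dCoef μ i * v j else 0)
      + (if j = i - 1 then (μ i + μ (i + 1)) / dCoef μ i * v j else 0) := by
    intro j
    simp only [Amat, Matrix.of_apply]
    by_cases a : j = i + 1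
    · subst a; simp [h1.symm]
    · by_cases b : j = i - 1 <;> simp [a, b, h1]
  simp only [Matrix.mulVec, dotProduct, key, Finset.sum_add_distrib]
  simp

theorem aux_M {n : ℕ} [NeZero n] (hn : 3 ≤ n) (μ v : Fin n → ℝ) (i : Fin n) :
    (Mdel μ).mulVec v i = (μ i + μ (i + 1)) / dCoef μ (i + 1) * v (i + 1)
      + (μ i + μ (i + 1)) / dCoef μ i * v (i - 1)
      + (-((μ (i + 1) + μ (i + 1 + 1)) / dCoef μ (i + 1)) - (μ (i - 1) + μ i) / dCoef μ i)
        * v i := by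
  have h1 := aux_ne1 hn i
  have h2 := aux_ne2 hn i
  have h3 := aux_ne3 hn i
  have key : ∀ j, Mdel μ i j * v j =
      (if j = i + 1 then (μ i + μ (i + 1)) / dCoef μ (i + 1) * v j else 0)
      + (if j = i - 1 then (μ i + μ (i + 1)) / dCoef μ i * v j else 0)
      + (if j = i then (-((μ (i + 1) + μ (i + 1 + 1)) / dCoef μ (i + 1))
          - (μ (i - 1) + μ i) / dCoef μ i) * v j else 0) := by
    intro j
    simp only [Mdel, Matrix.of_apply]
    by_cases a : j = i + 1
    · rw [if_pos a, if_pos a, if_neg (by rw [a]; exact h1.symm), if_neg (by rw [a]; exact h2.symm)]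
      ring
    · by_cases b : j = i - 1
      · rw [if_neg a, if_neg a, if_pos b, if_pos b, if_neg (by rw [b]; exact h3.symm)]
        ring
      · by_cases c : j = i
        · rw [if_neg a, if_neg a, if_neg b, if_neg b, if_pos c, if_pos c]
          ring
        · rw [if_neg a, if_neg a, if_neg b, if_neg b, if_neg c, if_neg c]
          ring
  simp only [Matrix.mulVec, dotProduct, key, Finset.sum_add_distrib]
  simp

/-- The right-hand side of the angular law in terms of the spacings. -/
theorem aux_rhs {n : ℕ} [NeZero n] (hn : 3 ≤ n) (μ v D : Fin n → ℝ) (hμ : ∀ i, 0 < μ i)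
    (hD : ∀ i, D i = v (i + 1) - v i + (if i = -1 then 2 * Real.pi else 0)) (i : Fin n) :
    ((Amat μ).mulVec v + bVec μ - v) i = (μ (i - 1) + μ i) / dCoef μ i * D i
      - (μ i + μ (i + 1)) / dCoef μ i * D (i - 1) := by
  have hd : 0 < dCoef μ i := by
    have := hμ i; have := hμ (i + 1); have := hμ (i - 1)
    unfold dCoef; linarith
  have hpq : (μ (i - 1) + μ i) / dCoef μ i + (μ i + μ (i + 1)) / dCoef μ i = 1 := by
    rw [← add_div, div_eq_one_iff_eq hd.ne']; unfold dCoef; ring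
  have h10 : (0 : Fin n) ≠ -1 := fun h => aux_one_ne hn (neg_eq_zero.mp h.symm)
  have hb : bVec μ i = (μ (i - 1) + μ i) / dCoef μ i * (if i = -1 then 2 * Real.pi else 0)
      - (μ i + μ (i + 1)) / dCoef μ i * (if i = 0 then 2 * Real.pi else 0) := by
    unfold bVec
    by_cases a : i = 0
    · rw [if_pos a, if_pos a, if_neg (by rw [a]; exact h10), a, zero_add]; ring
    · by_cases b : i = -1
      · rw [if_neg a, if_neg a, if_pos b, if_pos b, b]; ring
      · rw [if_neg a, if_neg a, if_neg b, if_neg b]; ring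
  have hc : (i - 1 = -1) ↔ i = 0 := by
    rw [sub_eq_iff_eq_add, neg_add_cancel]
  simp only [Pi.add_apply, Pi.sub_apply]
  rw [aux_A hn, hb, hD i, hD (i - 1), sub_add_cancel]
  simp only [hc]
  linear_combination (v i) * hpq

/-- The spacings `Δ` induced by the angular control law satisfy the spacing
dynamics `Δ' = k_φ M_Δ Δ`. -/
theorem spacing_dynamics (n : ℕ) [NeZero n] (hn : 3 ≤ n)
    (μ : Fin n → ℝ) (hμ : ∀ i, 0 < μ i)
    (kφ ωstar : ℝ) (hkφ : 0 < kφ)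
    (φ : ℝ → Fin n → ℝ)
    (hφ : ∀ (t : ℝ) (i : Fin n), HasDerivAt (fun s => φ s i)
      (ωstar + kφ * (((Amat μ).mulVec (φ t) + bVec μ - φ t) i)) t)
    (Δ : ℝ → Fin n → ℝ)
    (hΔ : ∀ (t : ℝ) (i : Fin n),
      Δ t i = φ t (i + 1) - φ t i + (if i = -1 then 2 * Real.pi else 0)) :
    ∀ (t : ℝ) (i : Fin n), HasDerivAt (fun s => Δ s i)
      (kφ * (((Mdel μ).mulVec (Δ t)) i)) t := by
  intro t i
  have h := (((hφ t (i + 1)).sub (hφ t i)).add_const (if i = -1 then 2 * Real.pi else 0))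
  have e : (fun s => Δ s i) =
      fun s => φ s (i + 1) - φ s i + (if i = -1 then 2 * Real.pi else 0) := by
    funext s; exact hΔ s i
  rw [e]
  refine HasDerivAt.congr_deriv h ?_
  rw [aux_rhs hn μ (φ t) (Δ t) hμ (hΔ t), aux_rhs hn μ (φ t) (Δ t) hμ (hΔ t), aux_M hn,
    add_sub_cancel_right]
  ring
end

section
/- (Theorem 2, order preservation.) Fix n ≥ 3, μ : Fin n → ℝ with μ_i > 0 for all i, and a gain k_φ > 0. Let M_Δ be the matrix with entries (M_Δ)_{i,i⁺} = (μ_i+μ_{i⁺})/d_{i⁺}, (M_Δ)_{i,i⁻} = (μ_i+μ_{i⁺})/d_i, (M_Δ)_{i,i} = −(μ_{i⁺}+μ_{i⁺⁺})/d_{i⁺} − (μ_{i⁻}+μ_i)/d_i, and all other entries 0. Suppose Δ : ℝ → ℝⁿ is differentiable with Δ'(t) = k_φ · M_Δ · Δ(t) for all t, and Δ_i(0) > 0 for all i. Then Δ_i(t) > 0 for every i and every t ≥ 0; that is, the robots keep their initial cyclic order during the whole circumnavigation process. -/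
open Matrix Filter Real

theorem Mdel_offdiag_nonneg {n : ℕ} [NeZero n] (μ : Fin n → ℝ) (hμ : ∀ i, 0 < μ i)
    (i j : Fin n) (h : j ≠ i) : 0 ≤ Mdel μ i j := by
  have hd : ∀ i, 0 < dCoef μ i := fun i => by
    have h1 := hμ (i + 1)
    have h2 := hμ i
    have h3 := hμ (i - 1)
    unfold dCoef
    positivity
  have h1 := hμ i
  have h2 := hμ (i + 1)
  have h3 := hd i
  have h4 := hd (i + 1)
  simp only [Mdel, Matrix.of_apply, if_neg h]
  split_ifs <;> positivity

/-- Positivity for linear systems with nonnegative off-diagonal coefficients. -/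
theorem metzler_pos {n : ℕ} (M : Matrix (Fin n) (Fin n) ℝ)
    (hM : ∀ i j, j ≠ i → 0 ≤ M i j) (k : ℝ) (hk : 0 < k) (Δ : ℝ → Fin n → ℝ)
    (hΔ : ∀ (t : ℝ) (i : Fin n), HasDerivAt (fun s => Δ s i) (k * ((M.mulVec (Δ t)) i)) t)
    (h0 : ∀ i, 0 < Δ 0 i) :
    ∀ t : ℝ, 0 ≤ t → ∀ i, 0 < Δ t i := by
  by_contra! hcon
  obtain ⟨t₀, ht₀, i₀, hi₀⟩ := hcon
  have hc : ∀ i, Continuous (fun s => Δ s i) := fun i =>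
    continuous_iff_continuousAt.2 fun t => (hΔ t i).continuousAt
  let S : Set ℝ := Set.Ici 0 ∩ ⋃ i, {t | Δ t i ≤ 0}
  have hS : IsClosed S :=
    isClosed_Ici.inter (isClosed_iUnion_of_finite fun i => isClosed_le (hc i) continuous_const)
  have hne : S.Nonempty := ⟨t₀, ht₀, Set.mem_iUnion.2 ⟨i₀, hi₀⟩⟩
  have hbdd : BddBelow S := ⟨0, fun x hx => hx.1⟩
  have hT := hS.csInf_mem hne hbdd
  set T := sInf S with hTdef
  obtain ⟨hT0, hT1⟩ := hT
  obtain ⟨i, hi⟩ := Set.mem_iUnion.1 hT1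
  have hT0' : 0 ≤ T := hT0
  have hi' : Δ T i ≤ 0 := hi
  have hpos : ∀ t, 0 ≤ t → t < T → ∀ j, 0 < Δ t j := by
    intro t ht htT j
    by_contra! hj
    exact absurd (csInf_le hbdd (show t ∈ S from ⟨ht, Set.mem_iUnion.2 ⟨j, hj⟩⟩)) (not_le.2 htT)
  have hder : ∀ t, HasDerivAt (fun s => Δ s i * Real.exp (-(k * M i i) * s))
      (Real.exp (-(k * M i i) * t) * (k * ∑ j ∈ Finset.univ.erase i, M i j * Δ t j)) t := by
    intro t
    have he : HasDerivAt (fun s : ℝ => Real.exp (-(k * M i i) * s))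
        (Real.exp (-(k * M i i) * t) * (-(k * M i i))) t := by
      simpa using ((hasDerivAt_id t).const_mul (-(k * M i i))).exp
    refine ((hΔ t i).mul he).congr_deriv ?_
    have hs : (M.mulVec (Δ t)) i
        = M i i * Δ t i + ∑ j ∈ Finset.univ.erase i, M i j * Δ t j :=
      (Finset.add_sum_erase Finset.univ (fun j => M i j * Δ t j) (Finset.mem_univ i)).symm
    rw [hs]
    ring
  have hmono : MonotoneOn (fun s => Δ s i * Real.exp (-(k * M i i) * s)) (Set.Icc 0 T) := by
    refine monotoneOn_of_deriv_nonneg (convex_Icc 0 T)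
      (fun t _ => (hder t).continuousAt.continuousWithinAt)
      (fun t _ => (hder t).differentiableAt.differentiableWithinAt) ?_
    intro t ht
    rw [interior_Icc] at ht
    rw [(hder t).deriv]
    refine mul_nonneg (Real.exp_pos _).le (mul_nonneg hk.le (Finset.sum_nonneg fun j hj => ?_))
    exact mul_nonneg (hM i j (Finset.ne_of_mem_erase hj)) (hpos t ht.1.le ht.2 j).le
  have h := hmono (Set.left_mem_Icc.2 hT0') (Set.right_mem_Icc.2 hT0') hT0'
  simp only [mul_zero, Real.exp_zero, mul_one] at h
  have h2 := mul_nonpos_of_nonpos_of_nonneg hi' (Real.exp_pos (-(k * M i i) * T)).le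
  linarith [h0 i]

/-- Theorem 2 (order preservation): if the spacings satisfy `Δ' = k_φ M_Δ Δ` and
are initially positive, they remain positive for all `t ≥ 0`, i.e. the robots keep
their initial cyclic order. -/
theorem order_preservation (n : ℕ) [NeZero n] (hn : 3 ≤ n)
    (μ : Fin n → ℝ) (hμ : ∀ i, 0 < μ i)
    (kφ : ℝ) (hkφ : 0 < kφ)
    (Δ : ℝ → Fin n → ℝ)
    (hΔ : ∀ (t : ℝ) (i : Fin n), HasDerivAt (fun s => Δ s i)
      (kφ * (((Mdel μ).mulVec (Δ t)) i)) t)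
    (h0 : ∀ i, 0 < Δ 0 i) :
    ∀ t : ℝ, 0 ≤ t → ∀ i, 0 < Δ t i := by
  exact metzler_pos (Mdel μ) (Mdel_offdiag_nonneg μ hμ) kφ hkφ Δ hΔ h0
end

section
/- Fix n ≥ 3 and μ : Fin n → ℝ with μ_i > 0 for all i. Let A be the matrix with A_{i,i⁺} = (μ_{i⁻}+μ_i)/d_i, A_{i,i⁻} = (μ_i+μ_{i⁺})/d_i and A_{i,j} = 0 otherwise, let L_p = I − A, define w_L ∈ ℝⁿ by (w_L)_i = d_i · ∏_{j ≠ i, j ≠ i⁻} (μ_j + μ_{j⁺}), and let P = diag(w_L) be the diagonal matrix with diagonal entries (w_L)_i. Then the symmetric matrix P·L_p + L_pᵀ·P is positive semidefinite. -/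
open Matrix Filter Real

/-- The matrix `A` acts by a weighted average of the two cyclic neighbours. -/
lemma Amat_mulVec_apply (n : ℕ) [NeZero n] (hn : 3 ≤ n) (μ x : Fin n → ℝ) (i : Fin n) :
    (Amat μ *ᵥ x) i = (μ (i - 1) + μ i) / dCoef μ i * x (i + 1) +
      (μ i + μ (i + 1)) / dCoef μ i * x (i - 1) := by
  obtain ⟨m, rfl⟩ : ∃ m, n = m + 3 := ⟨n - 3, by omega⟩
  have hne : i - 1 ≠ i + 1 := by
    intro h
    have h2 : (1 : Fin (m + 3)) + 1 = 0 := by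
      have h3 : i = i + (1 + 1) := by rw [← add_assoc, ← h, sub_add_cancel]
      simpa using h3.symm
    have h4 := congrArg Fin.val h2
    simp [Fin.val_add] at h4
    rw [Nat.mod_eq_of_lt (by omega)] at h4
    omega
  have key : ∀ j, Amat μ i j * x j =
      (if j = i + 1 then (μ (i - 1) + μ i) / dCoef μ i * x (i + 1) else 0) +
      (if j = i - 1 then (μ i + μ (i + 1)) / dCoef μ i * x (i - 1) else 0) := by
    intro j
    simp only [Amat, Matrix.of_apply]
    by_cases h1 : j = i + 1
    · subst h1
      simp [hne.symm]
    · by_cases h2 : j = i - 1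
      · subst h2
        simp [hne]
      · simp [h1, h2]
  simp only [Matrix.mulVec, dotProduct, key, Finset.sum_add_distrib]
  simp

/-- The product of all the sums splits off the two factors omitted in `wL`. -/
lemma prod_split (n : ℕ) [NeZero n] (hn : 3 ≤ n) (s : Fin n → ℝ) (i : Fin n) :
    ∏ j, s j = s i * s (i - 1) *
      ∏ j ∈ Finset.univ.filter (fun j => j ≠ i ∧ j ≠ i - 1), s j := by
  obtain ⟨m, rfl⟩ : ∃ m, n = m + 3 := ⟨n - 3, by omega⟩
  have hne : i - 1 ≠ i := by simp
  rw [← Finset.mul_prod_erase Finset.univ s (Finset.mem_univ i),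
    ← Finset.mul_prod_erase _ s (Finset.mem_erase.2 ⟨hne, Finset.mem_univ (i - 1)⟩), mul_assoc]
  congr 3
  ext j
  simp [and_comm]

/-- With `P = diag w_L`, the symmetric matrix `P L_p + L_pᵀ P` is positive
semidefinite. -/
theorem lyapunov_posSemidef (n : ℕ) [NeZero n] (hn : 3 ≤ n)
    (μ : Fin n → ℝ) (hμ : ∀ i, 0 < μ i) :
    (Matrix.diagonal (wL μ) * ((1 : Matrix (Fin n) (Fin n) ℝ) - Amat μ) +
      ((1 : Matrix (Fin n) (Fin n) ℝ) - Amat μ)ᵀ * Matrix.diagonal (wL μ)).PosSemidef := by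
  have hs : ∀ i, 0 < μ i + μ (i + 1) := fun i => add_pos (hμ _) (hμ _)
  set g : Fin n → ℝ := fun i => (∏ j, (μ j + μ (j + 1))) / (μ i + μ (i + 1)) with hg
  have hgpos : ∀ i, 0 ≤ g i := fun i =>
    div_nonneg (Finset.prod_nonneg fun j _ => (hs j).le) (hs i).le
  refine Matrix.PosSemidef.of_dotProduct_mulVec_nonneg ?_ ?_
  · rw [Matrix.IsHermitian, Matrix.conjTranspose_eq_transpose_of_trivial]
    simp only [Matrix.transpose_add, Matrix.transpose_mul, Matrix.transpose_transpose,
      Matrix.diagonal_transpose]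
    exact add_comm _ _
  · intro x
    have hrow : ∀ i, x i * (wL μ i * (x i - (Amat μ *ᵥ x) i)) =
        g i * (x i * (x i - x (i + 1))) + g (i - 1) * (x i * (x i - x (i - 1))) := by
      intro i
      have hd : dCoef μ i = (μ i + μ (i + 1)) + (μ (i - 1) + μ i) := by
        unfold dCoef; ring
      have h1 := hs i
      have h2 := hs (i - 1)
      rw [sub_add_cancel] at h2
      have hdpos : 0 < dCoef μ i := by rw [hd]; exact add_pos h1 h2
      have hsplit := prod_split n hn (fun j => μ j + μ (j + 1)) i
      simp only [sub_add_cancel] at hsplit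
      rw [Amat_mulVec_apply n hn]
      simp only [hg, wL, sub_add_cancel]
      rw [hsplit]
      generalize ∏ j ∈ Finset.univ.filter (fun j => j ≠ i ∧ j ≠ i - 1), (μ j + μ (j + 1)) = c
      have e1 := h1.ne'
      have e2 := h2.ne'
      have e3 := hdpos.ne'
      generalize dCoef μ i = d at *
      generalize μ i + μ (i + 1) = a at *
      generalize μ (i - 1) + μ i = b at *
      field_simp
      subst hd
      ring
    have hshift : ∑ i, g (i - 1) * (x i * (x i - x (i - 1))) =
        ∑ i, g i * (x (i + 1) * (x (i + 1) - x i)) := by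
      rw [← Equiv.sum_comp (Equiv.addRight (1 : Fin n))]
      simp
    have hhalf : x ⬝ᵥ ((Matrix.diagonal (wL μ) * (1 - Amat μ)) *ᵥ x) =
        ∑ i, g i * (x i - x (i + 1)) ^ 2 := by
      have : x ⬝ᵥ ((Matrix.diagonal (wL μ) * (1 - Amat μ)) *ᵥ x) =
          ∑ i, x i * (wL μ i * (x i - (Amat μ *ᵥ x) i)) := by
        simp only [← Matrix.mulVec_mulVec, dotProduct, Matrix.mulVec_diagonal,
          Matrix.sub_mulVec, Matrix.one_mulVec, Pi.sub_apply]
      rw [this, Finset.sum_congr rfl fun i _ => hrow i, Finset.sum_add_distrib, hshift,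
        ← Finset.sum_add_distrib]
      exact Finset.sum_congr rfl fun i _ => by ring
    have hT : (1 - Amat μ)ᵀ * Matrix.diagonal (wL μ) =
        (Matrix.diagonal (wL μ) * (1 - Amat μ))ᵀ := by
      rw [Matrix.transpose_mul, Matrix.diagonal_transpose]
    have hnn : 0 ≤ ∑ i, g i * (x i - x (i + 1)) ^ 2 :=
      Finset.sum_nonneg fun i _ => mul_nonneg (hgpos i) (sq_nonneg _)
    rw [star_trivial, hT, Matrix.add_mulVec, dotProduct_add, Matrix.mulVec_transpose,
      dotProduct_comm x (x ᵥ* _), ← Matrix.dotProduct_mulVec, hhalf]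
    exact add_nonneg hnn hnn
end
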